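/- arXiv:2309.15470 — 2 statements merged into one kernel-verified Lean document; each statement's English description precedes it below -/
import Mathlib

section
/- Let a, s, t be nonnegative integers and u a positive integer, and write C(u·C(m,s)·C(n,t), a) = Σ_{0 ≤ k ≤ sa, 0 ≤ l ≤ ta} α^a_{k,l} · C(m,k) · C(n,l) with integer coefficients α^a_{k,l} (this expansion exists and is unique). Then for all 0 ≤ k ≤ sa and 0 ≤ l ≤ ta: (a) if u·C(k,s)·C(l,t) < a then α^a_{k,l} = 0, and (b) if u·C(k,s)·C(l,t) ≥ a then α^a_{k,l} > 0. -/
/-- The one-variable binomial coefficient polynomial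
`C(X,k) = X(X-1)⋯(X-k+1)/k! ∈ ℚ[X]`. -/
noncomputable def binPoly (k : ℕ) : Polynomial ℚ :=
  Polynomial.C ((k.factorial : ℚ)⁻¹) * descPochhammer ℚ k

/-- The two-variable polynomial `C(m,k)·C(n,l) ∈ ℚ[m,n]`. -/
noncomputable def binMv (k l : ℕ) : MvPolynomial (Fin 2) ℚ :=
  Polynomial.aeval (MvPolynomial.X 0) (binPoly k) *
    Polynomial.aeval (MvPolynomial.X 1) (binPoly l)

lemma eval_binPoly_natCast (k n : ℕ) : (binPoly k).eval (n : ℚ) = n.choose k := by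
  have h : ((k.factorial : ℕ) : ℚ) ≠ 0 := by exact_mod_cast k.factorial_ne_zero
  rw [binPoly, Polynomial.eval_mul, Polynomial.eval_C, descPochhammer_eval_eq_descFactorial,
    Nat.descFactorial_eq_factorial_mul_choose, Nat.cast_mul, inv_mul_cancel_left₀ h]

lemma aeval_aeval_binPoly (v : Fin 2 → ℚ) (p : MvPolynomial (Fin 2) ℚ) (k : ℕ) :
    MvPolynomial.aeval v (Polynomial.aeval p (binPoly k)) =
      (binPoly k).eval (MvPolynomial.aeval v p) := by
  rw [← Polynomial.aeval_algHom_apply, Polynomial.coe_aeval_eq_eval]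

lemma aeval_binMv (m n k l : ℕ) :
    MvPolynomial.aeval ![(m : ℚ), (n : ℚ)] (binMv k l) = (m.choose k : ℚ) * n.choose l := by
  rw [binMv, map_mul, aeval_aeval_binPoly, aeval_aeval_binPoly, MvPolynomial.aeval_X,
    MvPolynomial.aeval_X, Matrix.cons_val_zero, Matrix.cons_val_one, Matrix.cons_val_fin_one,
    eval_binPoly_natCast, eval_binPoly_natCast]

/-- Evaluating an expansion in the basis `binMv k l` at natural numbers. -/
lemma choose_eq_sum_of_expansion {a s t u K L : ℕ} {α : ℕ → ℕ → ℤ}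
    (hα : Polynomial.aeval ((u : MvPolynomial (Fin 2) ℚ) * binMv s t) (binPoly a) =
      ∑ k ∈ Finset.range K, ∑ l ∈ Finset.range L, MvPolynomial.C ((α k l : ℚ)) * binMv k l)
    (m n : ℕ) :
    ((u * m.choose s * n.choose t).choose a : ℤ) =
      ∑ k ∈ Finset.range K, ∑ l ∈ Finset.range L, α k l * (m.choose k * n.choose l) := by
  have h := congrArg (MvPolynomial.aeval ![(m : ℚ), (n : ℚ)]) hα
  have e : (u : ℚ) * (m.choose s * n.choose t) = ((u * m.choose s * n.choose t : ℕ) : ℚ) := by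
    push_cast; ring
  rw [aeval_aeval_binPoly, map_mul, aeval_binMv, map_natCast, e, eval_binPoly_natCast] at h
  simp only [map_sum, map_mul, aeval_binMv, MvPolynomial.aeval_C, Algebra.algebraMap_self,
    RingHom.id_apply] at h
  exact_mod_cast h

/-- A function on finsets is determined by its sums over powersets. -/
lemma eq_of_sum_powerset_eq {ι M : Type*} [DecidableEq ι] [AddCommGroup M] {f g : Finset ι → M}
    (h : ∀ A : Finset ι, ∑ A' ∈ A.powerset, f A' = ∑ A' ∈ A.powerset, g A') (A : Finset ι) :
    f A = g A := by
  induction A using Finset.strongInduction with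
  | H A ih =>
    have hA := h A
    rw [← Finset.add_sum_erase _ _ (Finset.mem_powerset_self A),
      ← Finset.add_sum_erase _ g (Finset.mem_powerset_self A)] at hA
    have hrest : ∑ A' ∈ A.powerset.erase A, f A' = ∑ A' ∈ A.powerset.erase A, g A' :=
      Finset.sum_congr rfl fun A' hA' => ih A' (Finset.mem_ssubsets.1 hA')
    rw [hrest] at hA
    exact add_right_cancel hA

lemma eq_of_sum_powerset_sum_powerset_eq {ι κ M : Type*} [DecidableEq ι] [DecidableEq κ]
    [AddCommGroup M] {f g : Finset ι → Finset κ → M}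
    (h : ∀ (A : Finset ι) (B : Finset κ), ∑ A' ∈ A.powerset, ∑ B' ∈ B.powerset, f A' B' =
      ∑ A' ∈ A.powerset, ∑ B' ∈ B.powerset, g A' B') (A : Finset ι) (B : Finset κ) :
    f A B = g A B :=
  eq_of_sum_powerset_eq (fun B => eq_of_sum_powerset_eq (fun A => h A B) A) B

lemma sum_range_mul_choose_eq_sum_powerset {ι : Type*} (c : ℕ → ℤ) (N : ℕ) (A : Finset ι) :
    ∑ k ∈ Finset.range N, c k * (A.card.choose k : ℤ) =
      ∑ A' ∈ A.powerset, if A'.card < N then c A'.card else 0 := by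
  rw [Finset.sum_powerset_apply_card (fun k => if k < N then c k else 0)]
  simp only [nsmul_eq_mul, mul_ite, mul_zero, ← Finset.sum_filter]
  refine Finset.sum_subset_zero_on_sdiff (fun k hk => ?_) ?_ ?_ |>.symm
  · simp_all
  · intro k hk
    simp only [Finset.mem_sdiff, Finset.mem_range, Finset.mem_filter, not_and] at hk
    rw [Nat.choose_eq_zero_of_lt (by grind)]
    simp
  · intro k _
    ring

/-- The triples in `Fin u × Finset ℕ × Finset ℕ` formed by a label, an `s`-subset of `A` and a
`t`-subset of `B`. -/
def labelledPairs (s t u : ℕ) (A B : Finset ℕ) : Finset (Fin u × Finset ℕ × Finset ℕ) :=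
  Finset.univ ×ˢ Finset.powersetCard s A ×ˢ Finset.powersetCard t B

lemma mem_labelledPairs {s t u : ℕ} {A B : Finset ℕ} {x : Fin u × Finset ℕ × Finset ℕ} :
    x ∈ labelledPairs s t u A B ↔
      (x.2.1 ⊆ A ∧ x.2.1.card = s) ∧ x.2.2 ⊆ B ∧ x.2.2.card = t := by
  simp [labelledPairs]

lemma card_labelledPairs (s t u : ℕ) (A B : Finset ℕ) :
    (labelledPairs s t u A B).card = u * A.card.choose s * B.card.choose t := by
  simp [labelledPairs, mul_assoc]

/-- The `a`-element sets of labelled pairs that cover both `A` and `B`. -/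
def coveringFamilies (a s t u : ℕ) (A B : Finset ℕ) :
    Finset (Finset (Fin u × Finset ℕ × Finset ℕ)) :=
  {F ∈ Finset.powersetCard a (labelledPairs s t u A B) |
    F.biUnion (fun x => x.2.1) = A ∧ F.biUnion (fun x => x.2.2) = B}

lemma sum_card_coveringFamilies (a s t u : ℕ) (A B : Finset ℕ) :
    ∑ A' ∈ A.powerset, ∑ B' ∈ B.powerset, (coveringFamilies a s t u A' B').card =
      (u * A.card.choose s * B.card.choose t).choose a := by
  rw [← card_labelledPairs, ← Finset.card_powersetCard, ← Finset.sum_product',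
    Finset.card_eq_sum_card_fiberwise (t := A.powerset ×ˢ B.powerset)
      (f := fun F => (F.biUnion (fun x => x.2.1), F.biUnion (fun x => x.2.2)))]
  · refine Finset.sum_congr rfl fun p hp => congrArg Finset.card ?_
    obtain ⟨A', B'⟩ := p
    simp only [Finset.mem_product, Finset.mem_powerset] at hp
    ext F
    simp only [coveringFamilies, Finset.mem_filter, Finset.mem_powersetCard, Prod.mk.injEq]
    refine and_congr_left fun ⟨h₁, h₂⟩ => and_congr_left fun _ => ⟨fun h x hx => ?_,
      fun h x hx => ?_⟩
    · have hm := mem_labelledPairs.1 (h hx)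
      exact mem_labelledPairs.2 ⟨⟨hm.1.1.trans hp.1, hm.1.2⟩, hm.2.1.trans hp.2, hm.2.2⟩
    · have hm := mem_labelledPairs.1 (h hx)
      refine mem_labelledPairs.2 ⟨⟨?_, hm.1.2⟩, ?_, hm.2.2⟩
      · exact h₁ ▸ Finset.subset_biUnion_of_mem (fun x => x.2.1) hx
      · exact h₂ ▸ Finset.subset_biUnion_of_mem (fun x => x.2.2) hx
  · intro F hF
    have hF' := (Finset.mem_powersetCard.1 (Finset.mem_coe.1 hF)).1
    simp only [Finset.coe_product, Set.mem_prod, Finset.mem_coe, Finset.mem_powerset,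
      Finset.biUnion_subset]
    exact ⟨fun x hx => (mem_labelledPairs.1 (hF' hx)).1.1,
      fun x hx => (mem_labelledPairs.1 (hF' hx)).2.1⟩

/-- A set with at least `s` and at most `s * a` elements is a union of `a` of its `s`-subsets. -/
lemma exists_cover_by_subsets_of_card {ι : Type*} [DecidableEq ι] {s a : ℕ} (ha : a ≠ 0)
    {A : Finset ι} (hs : s ≤ A.card) (hA : A.card ≤ s * a) :
    ∃ p : ℕ → Finset ι, (∀ i, p i ⊆ A ∧ (p i).card = s) ∧ ∀ x ∈ A, ∃ i < a, x ∈ p i := by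
  induction a, Nat.one_le_iff_ne_zero.2 ha using Nat.le_induction generalizing A with
  | base =>
    exact ⟨fun _ => A, fun _ => ⟨subset_rfl, le_antisymm (by simpa using hA) hs⟩, fun x hx => ⟨0, one_pos, hx⟩⟩
  | succ a h1 ih =>
    have hsa : s ≤ s * a := Nat.le_mul_of_pos_right s h1
    obtain ⟨A', hA', hcard⟩ := Finset.exists_subset_card_eq (min_le_left A.card (s * a))
    obtain ⟨p, hp, hcov⟩ := ih (by omega) (A := A') (by omega) (by omega)
    have hdiff : (A \ A').card ≤ s := by
      rw [Finset.card_sdiff_of_subset hA']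
      rw [mul_add, mul_one] at hA
      omega
    obtain ⟨S, hS, hSA, hScard⟩ :=
      Finset.exists_subsuperset_card_eq Finset.sdiff_subset hdiff hs
    refine ⟨Function.update p a S, fun i => ?_, fun x hx => ?_⟩
    · rcases eq_or_ne i a with rfl | hi
      · simpa using ⟨hSA, hScard⟩
      · simpa [hi] using ⟨(hp i).1.trans hA', (hp i).2⟩
    · by_cases hx' : x ∈ A'
      · obtain ⟨i, hi, hxi⟩ := hcov x hx'
        exact ⟨i, by omega, by simpa [hi.ne] using hxi⟩
      · exact ⟨a, by omega, by simpa using hS (Finset.mem_sdiff.2 ⟨hx, hx'⟩)⟩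

lemma coveringFamilies_nonempty {a s t u : ℕ} {A B : Finset ℕ} (hA : A.card ≤ s * a)
    (hB : B.card ≤ t * a) (h : a ≤ u * A.card.choose s * B.card.choose t) :
    (coveringFamilies a s t u A B).Nonempty := by
  rcases eq_or_ne a 0 with rfl | ha
  · obtain rfl : A = ∅ := by simpa using hA
    obtain rfl : B = ∅ := by simpa using hB
    exact ⟨∅, by simp [coveringFamilies]⟩
  have hpos : u * A.card.choose s * B.card.choose t ≠ 0 := by omega
  simp only [ne_eq, mul_eq_zero, not_or, Nat.choose_eq_zero_iff, not_lt] at hpos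
  obtain ⟨⟨hu, hs⟩, ht⟩ := hpos
  obtain ⟨p, hp, hpA⟩ := exists_cover_by_subsets_of_card ha hs hA
  obtain ⟨q, hq, hqB⟩ := exists_cover_by_subsets_of_card ha ht hB
  let e : ℕ → Fin u × Finset ℕ × Finset ℕ := fun i => (⟨0, Nat.pos_of_ne_zero hu⟩, p i, q i)
  have hsub : (Finset.range a).image e ⊆ labelledPairs s t u A B := by
    intro x hx
    obtain ⟨i, -, rfl⟩ := Finset.mem_image.1 hx
    exact mem_labelledPairs.2 ⟨hp i, hq i⟩
  have hcard : ((Finset.range a).image e).card ≤ a := by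
    simpa using Finset.card_image_le (s := Finset.range a) (f := e)
  obtain ⟨F, heF, hF, hFcard⟩ :=
    Finset.exists_subsuperset_card_eq hsub hcard (h.trans_eq (card_labelledPairs ..).symm)
  have hmem : ∀ i < a, e i ∈ F := fun i hi =>
    heF (Finset.mem_image_of_mem e (Finset.mem_range.2 hi))
  refine ⟨F, Finset.mem_filter.2 ⟨Finset.mem_powersetCard.2 ⟨hF, hFcard⟩, ?_, ?_⟩⟩
  · refine subset_antisymm (Finset.biUnion_subset.2 fun x hx => (mem_labelledPairs.1 (hF hx)).1.1)
      fun y hy => ?_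
    obtain ⟨i, hi, hyi⟩ := hpA y hy
    exact Finset.mem_biUnion.2 ⟨e i, hmem i hi, hyi⟩
  · refine subset_antisymm (Finset.biUnion_subset.2 fun x hx => (mem_labelledPairs.1 (hF hx)).2.1)
      fun y hy => ?_
    obtain ⟨i, hi, hyi⟩ := hqB y hy
    exact Finset.mem_biUnion.2 ⟨e i, hmem i hi, hyi⟩

/-- The coefficients of the expansion count covering families. -/
lemma card_coveringFamilies_eq_coeff {a s t u K L : ℕ} {α : ℕ → ℕ → ℤ}
    (hα : Polynomial.aeval ((u : MvPolynomial (Fin 2) ℚ) * binMv s t) (binPoly a) =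
      ∑ k ∈ Finset.range K, ∑ l ∈ Finset.range L, MvPolynomial.C ((α k l : ℚ)) * binMv k l)
    {A B : Finset ℕ} (hA : A.card < K) (hB : B.card < L) :
    ((coveringFamilies a s t u A B).card : ℤ) = α A.card B.card := by
  have key := eq_of_sum_powerset_sum_powerset_eq
    (f := fun A B : Finset ℕ => ((coveringFamilies a s t u A B).card : ℤ))
    (g := fun A B => if A.card < K then if B.card < L then α A.card B.card else 0 else 0)
    (fun A B => ?_) A B
  · simpa [hA, hB] using key
  · have hsum := sum_card_coveringFamilies a s t u A B
    zify at hsum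
    rw [hsum, choose_eq_sum_of_expansion hα]
    have hinner : ∀ k, ∑ l ∈ Finset.range L, α k l * ((A.card.choose k : ℤ) * B.card.choose l) =
        (∑ B' ∈ B.powerset, if B'.card < L then α k B'.card else 0) * A.card.choose k := by
      intro k
      rw [← sum_range_mul_choose_eq_sum_powerset, Finset.sum_mul]
      exact Finset.sum_congr rfl fun l _ => by ring
    rw [Finset.sum_congr rfl fun k _ => hinner k, sum_range_mul_choose_eq_sum_powerset
      (fun k => ∑ B' ∈ B.powerset, if B'.card < L then α k B'.card else 0)]
    refine Finset.sum_congr rfl fun A' _ => ?_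
    split_ifs <;> simp

/-- Let `a, s, t` be nonnegative integers and `u` a positive integer, and write
`C(u·C(m,s)·C(n,t), a) = Σ_{0 ≤ k ≤ sa, 0 ≤ l ≤ ta} α^a_{k,l}·C(m,k)·C(n,l)` with integer
coefficients. Then for `0 ≤ k ≤ sa` and `0 ≤ l ≤ ta`:
(a) if `u·C(k,s)·C(l,t) < a` then `α^a_{k,l} = 0`;
(b) if `u·C(k,s)·C(l,t) ≥ a` then `α^a_{k,l} > 0`. -/
theorem coeff_vanishing_and_positivity (a s t u : ℕ) (hu : 0 < u) (α : ℕ → ℕ → ℤ)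
    (hα : Polynomial.aeval ((u : MvPolynomial (Fin 2) ℚ) * binMv s t) (binPoly a) =
      ∑ k ∈ Finset.range (s * a + 1), ∑ l ∈ Finset.range (t * a + 1),
        MvPolynomial.C ((α k l : ℚ)) * binMv k l) :
    ∀ k l : ℕ, k ≤ s * a → l ≤ t * a →
      (u * k.choose s * l.choose t < a → α k l = 0) ∧
      (a ≤ u * k.choose s * l.choose t → 0 < α k l) := by
  intro k l hk hl
  have hcount := card_coveringFamilies_eq_coeff hα (A := Finset.range k) (B := Finset.range l)
    (by simpa using Nat.lt_succ_of_le hk) (by simpa using Nat.lt_succ_of_le hl)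
  rw [Finset.card_range, Finset.card_range] at hcount
  rw [← hcount]
  refine ⟨fun h => ?_, fun h => ?_⟩
  · rw [coveringFamilies, Finset.powersetCard_eq_empty.2 (by simpa [card_labelledPairs] using h)]
    simp
  · exact_mod_cast (coveringFamilies_nonempty (by simpa using hk) (by simpa using hl)
      (by simpa using h)).card_pos
end

section
/- Let a be a positive integer and let k be an integer with ⌈a/2⌉ + 1 ≤ k ≤ a. Then, as an equality of rational numbers, Σ_{x=a-k+1}^{⌊a/2⌋} (a - 2x)·C(a-x, k-x)·C(k-1, a-x) = ( ((2k-a)/2)·C(2k-a-1, ⌈(2k-a-1)/2⌉) − 2^{2k-a-2} ) · C(k-1, 2k-a-1). (Note 2k - a - 2 ≥ 0 under the stated hypothesis on k.) -/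
theorem sum_range_sub_two_mul_mul_choose (n m : ℕ) :
    ∑ j ∈ Finset.range m, ((n : ℚ) - 2 * j) * (n.choose j : ℚ) = m * (n.choose m : ℚ) := by
  induction m with
  | zero => simp
  | succ m ih =>
    rw [Finset.sum_range_succ, ih]
    have h : (n.choose (m + 1) : ℚ) * (m + 1) = n.choose m * ((n : ℚ) - m) := by
      rcases le_or_gt m n with hm | hm
      · have := Nat.choose_succ_right_eq n m
        rw [← Nat.cast_sub hm]
        exact_mod_cast this
      · simp [Nat.choose_eq_zero_of_lt hm, Nat.choose_eq_zero_of_lt (Nat.lt_succ_of_lt hm)]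
    push_cast
    linear_combination -h

theorem sum_range_choose_succ_add_choose (n m : ℕ) :
    ∑ j ∈ Finset.range (m + 1), (n + 1).choose j + n.choose m =
      2 * ∑ j ∈ Finset.range (m + 1), n.choose j := by
  induction m with
  | zero => simp
  | succ m ih =>
    rw [Finset.sum_range_succ, Finset.sum_range_succ _ (m + 1), Nat.choose_succ_succ']
    omega

theorem sum_range_half_sub_one_sub_two_mul_mul_choose (n : ℕ) :
    ∑ j ∈ Finset.range (n / 2 + 1), ((n : ℚ) - 2 * j) * ((n + 1).choose j : ℚ) =
      ((n : ℚ) + 2) / 2 * ((n + 1).choose ((n + 2) / 2) : ℚ) - 2 ^ n := by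
  have split : ∑ j ∈ Finset.range (n / 2 + 1), ((n : ℚ) - 2 * j) * ((n + 1).choose j : ℚ) =
      ((n / 2 + 1 : ℕ) : ℚ) * ((n + 1).choose (n / 2 + 1) : ℚ) -
        ((∑ j ∈ Finset.range (n / 2 + 1), (n + 1).choose j : ℕ) : ℚ) := by
    rw [← sum_range_sub_two_mul_mul_choose, Nat.cast_sum, ← Finset.sum_sub_distrib]
    refine Finset.sum_congr rfl fun j _ => ?_
    push_cast
    ring
  rw [split, Nat.add_div_right n two_pos]
  obtain ⟨m, rfl | rfl⟩ := n.even_or_odd'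
  · rw [Nat.mul_div_cancel_left m two_pos, Nat.sum_range_choose_halfway, pow_mul]
    push_cast
    ring
  · have hm : (2 * m + 1) / 2 = m := by omega
    have hsum := sum_range_choose_succ_add_choose (2 * m + 1) m
    rw [Nat.sum_range_choose_halfway] at hsum
    have hsymm : (2 * m + 1).choose (m + 1) = (2 * m + 1).choose m := Nat.choose_symm_half m
    have hc := Nat.choose_succ_succ' (2 * m + 1) m
    rw [hsymm] at hc
    rw [hm, pow_succ, pow_mul]
    have hsumQ : ((∑ j ∈ Finset.range (m + 1), (2 * m + 1 + 1).choose j : ℕ) : ℚ) +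
        ((2 * m + 1).choose m : ℚ) = 2 * 4 ^ m := by exact_mod_cast hsum
    have hcQ : ((2 * m + 1 + 1).choose (m + 1) : ℚ) =
        (2 * m + 1).choose m + (2 * m + 1).choose m := by exact_mod_cast hc
    rw [hcQ]
    push_cast at hsumQ ⊢
    linear_combination -hsumQ

/-- Let `a` be a positive integer and `k` an integer with `⌈a/2⌉ + 1 ≤ k ≤ a`. Then, in `ℚ`,
`Σ_{x=a-k+1}^{⌊a/2⌋} (a-2x)·C(a-x,k-x)·C(k-1,a-x)
  = ( ((2k-a)/2)·C(2k-a-1, ⌈(2k-a-1)/2⌉) − 2^{2k-a-2} )·C(k-1, 2k-a-1)`.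
(Here `⌈(2k-a-1)/2⌉ = (2k-a-1+1)/2` in natural-number division, and `2k-a-2 ≥ 0`.) -/
theorem sum_coeff_b_eq_two_m (a k : ℕ) (ha : 0 < a)
    (hk1 : (a + 1) / 2 + 1 ≤ k) (hk2 : k ≤ a) :
    ∑ x ∈ Finset.Icc (a - k + 1) (a / 2),
        ((a - 2 * x : ℕ) : ℚ) * ((a - x).choose (k - x) : ℚ) * ((k - 1).choose (a - x) : ℚ) =
      (((2 * k - a : ℕ) : ℚ) / 2 * ((2 * k - a - 1).choose ((2 * k - a - 1 + 1) / 2) : ℚ)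
          - 2 ^ (2 * k - a - 2)) * ((k - 1).choose (2 * k - a - 1) : ℚ) := by
  obtain ⟨d, rfl⟩ := Nat.exists_eq_add_of_le hk2
  obtain ⟨n, rfl⟩ : ∃ n, k = n + d + 2 := ⟨k - d - 2, by omega⟩
  have e1 : 2 * (n + d + 2) - (n + d + 2 + d) = n + 2 := by omega
  have e2 : (n + d + 2 + d) / 2 = n / 2 + d + 1 := by omega
  have e3 : n + d + 2 - 1 = n + 1 + d := by omega
  have e4 : n + d + 2 + d - (n + d + 2) + 1 = d + 1 := by omega
  rw [e1, e2, e3, e4, show n + 2 - 1 = n + 1 by omega, Nat.add_sub_cancel]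
  have key := sum_range_half_sub_one_sub_two_mul_mul_choose n
  push_cast
  rw [← key, Finset.sum_mul, ← Finset.Ico_add_one_right_eq_Icc, Finset.sum_Ico_eq_sum_range,
    show n / 2 + d + 1 + 1 - (d + 1) = n / 2 + 1 by omega]
  refine Finset.sum_congr rfl fun j hj => ?_
  rw [Finset.mem_range] at hj
  have f1 : n + d + 2 + d - 2 * (d + 1 + j) = n - 2 * j := by omega
  have f2 : n + d + 2 + d - (d + 1 + j) = n + 1 + d - j := by omega
  have f3 : n + d + 2 - (d + 1 + j) = n + 1 + d - j - d := by omega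
  have hprod : (n + 1 + d - j).choose d * (n + 1 + d).choose j =
      (n + 1).choose j * (n + 1 + d).choose (n + 1) := by
    have h := Nat.choose_mul (n := n + 1 + d) (k := n + 1) (s := j) (by omega)
    rw [show n + 1 + d - j = d + (n + 1 - j) by omega] at h ⊢
    rw [Nat.choose_symm_add, mul_comm, ← h, mul_comm]
  rw [f1, f2, f3, Nat.choose_symm (by omega), Nat.choose_symm (by omega),
    Nat.cast_sub (by omega), mul_assoc, mul_assoc]
  push_cast
  congr 1
  exact_mod_cast hprod
end
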